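/- Let a ∈ I₁ be a non-scalar element (a ∉ K·1). Then Cen_{I₁}(a) is a finitely generated K-algebra if and only if a does not belong to the set (K[H]+F) \ (K+F); that is, if and only if a ∉ K[H]+F or a ∈ K+F. -/

import Mathlib

open Polynomial

noncomputable section
set_option synthInstance.maxHeartbeats 1000000
set_option maxHeartbeats 1000000
set_option linter.unusedSectionVars false

variable (K : Type*) [Field K] [CharZero K]

/-- The derivative operator `∂ = d/dx` on `K[x]`. -/
def derOp : Module.End K (Polynomial K) := Polynomial.derivative

/-- The multiplication-by-`x` operator on `K[x]`. -/
def xOp : Module.End K (Polynomial K) := LinearMap.mulLeft K Polynomial.X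

/-- The integration operator `∫`, determined by `∫ xⁿ = xⁿ⁺¹/(n+1)`. -/
def intOp : Module.End K (Polynomial K) :=
  (Polynomial.basisMonomials K).constr K fun n => ((n : K) + 1)⁻¹ • X ^ (n + 1)

/-- The algebra `I₁` of polynomial integro-differential operators: the subalgebra of
`End_K(K[x])` generated by `x`, `∂` and `∫`. -/
def I1 : Subalgebra K (Module.End K (Polynomial K)) :=
  Algebra.adjoin K {xOp K, derOp K, intOp K}

/-- `e_{ij} := ∫^i ∂^j − ∫^{i+1} ∂^{j+1}`. -/
def eOp (i j : ℕ) : Module.End K (Polynomial K) :=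
  intOp K ^ i * derOp K ^ j - intOp K ^ (i + 1) * derOp K ^ (j + 1)

/-- `F`, the `K`-linear span of the `e_{ij}`; it is the (two-sided) ideal of compact
operators of `I₁`. -/
def Fset : Submodule K (Module.End K (Polynomial K)) :=
  Submodule.span K {f | ∃ i j, f = eOp K i j}

lemma xOp_mem : xOp K ∈ I1 K := Algebra.subset_adjoin (by simp)
lemma derOp_mem : derOp K ∈ I1 K := Algebra.subset_adjoin (by simp)
lemma intOp_mem : intOp K ∈ I1 K := Algebra.subset_adjoin (by simp)

lemma eOp_mem (i j : ℕ) : eOp K i j ∈ I1 K :=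
  sub_mem (mul_mem (pow_mem (intOp_mem K) i) (pow_mem (derOp_mem K) j))
    (mul_mem (pow_mem (intOp_mem K) (i + 1)) (pow_mem (derOp_mem K) (j + 1)))

/-- `e_{ij}` as an element of the ring `I₁`. -/
def eI (i j : ℕ) : I1 K := ⟨eOp K i j, eOp_mem K i j⟩

/-- `∂` as an element of the ring `I₁`. -/
def derI : I1 K := ⟨derOp K, derOp_mem K⟩

/-- `∫` as an element of the ring `I₁`. -/
def intI : I1 K := ⟨intOp K, intOp_mem K⟩

/-- `H := ∂ ∘ x` (first multiply by `x`, then differentiate). -/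
def hOp : Module.End K (Polynomial K) := derOp K * xOp K

/-- `K[H]`, the unital subalgebra of `I₁` generated by `H`. -/
def KH : Subalgebra K (Module.End K (Polynomial K)) := Algebra.adjoin K {hOp K}

/-- The action of `a ∈ I₁` on a left `I₁`-module `M`, as a `K`-linear map `a_M : M → M`. -/
def actMap (a : I1 K) (M : Type*) [AddCommGroup M] [Module (I1 K) M] [Module K M]
    [SMulCommClass K (I1 K) M] : M →ₗ[K] M where
  toFun m := a • m
  map_add' := smul_add a
  map_smul' k m := (smul_comm k a m).symm

/-- Right multiplication `b ↦ b * a` in a ring `R`, as a homomorphism of left `R`-modules. -/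
def rmulMap (R : Type*) [Ring R] (a : R) : R →ₗ[R] R where
  toFun b := b * a
  map_add' b c := add_mul b c a
  map_smul' c b := by simp [smul_eq_mul, mul_assoc]

/-- Left multiplication `b ↦ a * b` in a ring `R`, as a homomorphism of right `R`-modules
(i.e. of left `Rᵐᵒᵖ`-modules). -/
def lmulMap (R : Type*) [Ring R] (a : R) : R →ₗ[Rᵐᵒᵖ] R where
  toFun b := a * b
  map_add' b c := mul_add a b c
  map_smul' c b := by simp [MulOpposite.smul_eq_mul_unop, mul_assoc]

/-- The centralizer `Cen_{I₁}(a) = {b ∈ I₁ : ab = ba}` of `a` in `I₁`, as a subalgebra of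
`End_K(K[x])`. -/
def Cen (a : Module.End K (Polynomial K)) : Subalgebra K (Module.End K (Polynomial K)) :=
  I1 K ⊓ Subalgebra.centralizer K {a}

/-- `Cen_F(a) = {f ∈ F : af = fa}`, a `K`-subspace of `End_K(K[x])`. -/
def CenF (a : Module.End K (Polynomial K)) : Submodule K (Module.End K (Polynomial K)) :=
  Fset K ⊓ Subalgebra.toSubmodule (Subalgebra.centralizer K {a})



section GeneralAlgebra

variable {K}

/-- If `C` acts faithfully on `W` by operators commuting with `T`, the element `z` acting as `T`,
and `W` is finitely generated over `K[T]`, then `C` is a finitely generated algebra. -/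
lemma finiteType_of_injective_end {C W : Type*} [Ring C] [Algebra K C] [AddCommGroup W]
    [Module K W] (z : C) (T : Module.End K W) (ρ : C →ₗ[K] Module.End K W)
    (hinj : Function.Injective ρ) (hl : ∀ c, ρ (z * c) = T * ρ c) (hr : ∀ c, ρ (c * z) = ρ c * T)
    (hz : ∀ c, z * c = c * z) [Module.Finite K[X] (Module.AEval' T)] : Algebra.FiniteType K C := by
  let _ : Algebra K[X] C := (aeval z : K[X] →ₐ[K] C).toRingHom.toAlgebra' (by
    intro p c
    induction p using Polynomial.induction_on' with
    | add p q hp hq => simp only [map_add, add_mul, mul_add, hp, hq]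
    | monomial n k =>
      have : Commute (z ^ n) c := Commute.pow_left (hz c) n
      change aeval z _ * c = c * aeval z _
      rw [aeval_monomial, mul_assoc, this.eq, ← mul_assoc, ← mul_assoc, Algebra.commutes])
  have halg (p : K[X]) (c : C) : p • c = aeval z p * c := rfl
  have hst : IsScalarTower K K[X] C := ⟨fun k p c => by simp [halg]⟩
  have hcomm (c : C) (w : W) : ρ c (T w) = T (ρ c w) := by
    have := (hr c).symm.trans ((congrArg ρ (hz c).symm).trans (hl c))
    exact congrArg (fun f : Module.End K W => f w) this
  let f (c : C) : Module.AEval' T →ₗ[K[X]] Module.AEval' T :=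
    LinearMap.ofAEval T ((Module.AEval'.of T).toLinearMap ∘ₗ ρ c) (by
      intro w
      change _ = (X : K[X]) • Module.AEval'.of T (ρ c w)
      rw [Module.AEval'.X_smul_of, ← hcomm]
      rfl)
  have hf (c : C) (w : W) : f c (Module.AEval'.of T w) = Module.AEval'.of T (ρ c w) := rfl
  let g : C →ₗ[K[X]] (Module.AEval' T →ₗ[K[X]] Module.AEval' T) :=
    { toFun := f
      map_add' := fun c d => by
        ext w
        obtain ⟨w, rfl⟩ := (Module.AEval'.of T).surjective w
        simp [hf]
      map_smul' := fun p c => by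
        ext w
        obtain ⟨w, rfl⟩ := (Module.AEval'.of T).surjective w
        rw [LinearMap.smul_apply, hf, hf, halg]
        simp only [RingHom.id_apply]
        induction p using Polynomial.induction_on with
        | C k =>
          rw [aeval_C, ← Algebra.smul_def]
          simp
        | add p q hp hq => simp only [map_add, add_mul, add_smul, LinearMap.add_apply, hp, hq]
        | monomial n k h =>
          have : aeval z (Polynomial.C k * X ^ (n + 1)) * c = z * (aeval z (Polynomial.C k * X ^ n) * c) := by
            simp only [map_mul, map_pow, aeval_X, aeval_C, ← mul_assoc]
            rw [← Algebra.commutes k z, pow_succ']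
            simp only [mul_assoc]
          rw [this, hl, Module.End.mul_apply, ← Module.AEval'.X_smul_of, h, ← mul_smul]
          congr 1
          ring }
  have hg : Function.Injective g := by
    intro c d h
    apply hinj
    ext1 w
    have := LinearMap.congr_fun h (Module.AEval'.of T w)
    exact (Module.AEval'.of T).injective this
  obtain ⟨s, hs⟩ := (inferInstance : Module.Finite K[X] (Module.AEval' T)).fg_top
  let ev : (Module.AEval' T →ₗ[K[X]] Module.AEval' T) →ₗ[K[X]] (s → Module.AEval' T) :=
    LinearMap.pi fun i => LinearMap.applyₗ (i : Module.AEval' T)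
  have hev : Function.Injective ev := by
    intro u v h
    apply LinearMap.ext_on hs
    intro x hx
    exact congrFun h ⟨x, hx⟩
  have : IsNoetherian K[X] C := isNoetherian_of_injective (ev ∘ₗ g)
    (by rw [LinearMap.coe_comp]; exact hev.comp hg)
  exact Algebra.FiniteType.trans (S := K[X]) inferInstance inferInstance

/-- If `T` raises the degree of almost all members of a spanning sequence, then the space is
finitely generated over `K[T]`. -/
lemma finite_aeval_of_raises {W : Type*} [AddCommGroup W] [Module K W] (T : Module.End K W)
    (w : ℕ → W) (hw : Submodule.span K (Set.range w) = ⊤) (N d : ℕ) (hd : 0 < d)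
    (h : ∀ n ≥ N, w (n + d) ∈ Submodule.span K (insert (T (w n)) (w '' Set.Iio (n + d)))) :
    Module.Finite K[X] (Module.AEval' T) := by
  classical
  let o : W ≃ₗ[K] Module.AEval' T := Module.AEval'.of T
  refine ⟨(Finset.range (N + d)).image (o ∘ w), ?_⟩
  set S := Submodule.span K[X] (((Finset.range (N + d)).image (o ∘ w) : Finset _) :
    Set (Module.AEval' T)) with hS
  let S' : Submodule K W := (S.restrictScalars K).comap o.toLinearMap
  have key : ∀ n, w n ∈ S' := by
    intro n
    induction n using Nat.strong_induction_on with
    | _ n ih =>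
      by_cases hn : n < N + d
      · change o (w n) ∈ S
        exact Submodule.subset_span (by simpa using ⟨n, hn, rfl⟩)
      · obtain ⟨k, rfl⟩ : ∃ k, n = k + d := ⟨n - d, by omega⟩
        refine (Submodule.span_le.2 ?_) (h k (by omega))
        rintro _ (rfl | ⟨m, hm, rfl⟩)
        · change o (T (w k)) ∈ S
          rw [← Module.AEval'.X_smul_of]
          exact S.smul_mem _ (ih k (by omega))
        · exact ih m hm
  rw [eq_top_iff]
  intro v _
  obtain ⟨v, rfl⟩ := o.surjective v
  have : Submodule.span K (Set.range w) ≤ S' := Submodule.span_le.2 (by rintro _ ⟨n, rfl⟩; exact key n)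
  rw [hw] at this
  exact this (Submodule.mem_top (x := v))

end GeneralAlgebra

section Basis

variable {K}

/-- The divided power `xⁿ / n!`. -/
def divPow (K : Type*) [Field K] (n : ℕ) : K[X] := monomial n ((n.factorial : K)⁻¹)

/-- The coordinate with respect to the basis of divided powers. -/
def coord (K : Type*) [Field K] (m : ℕ) : K[X] →ₗ[K] K := (m.factorial : K) • lcoeff K m

lemma coord_apply (m : ℕ) (v : K[X]) : coord K m v = (m.factorial : K) * v.coeff m := rfl

lemma factorial_cast_ne (n : ℕ) : (n.factorial : K) ≠ 0 := by
  exact_mod_cast n.factorial_ne_zero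

lemma coord_divPow (m n : ℕ) : coord K m (divPow K n) = if m = n then 1 else 0 := by
  rw [coord_apply, divPow, coeff_monomial]
  by_cases h : m = n
  · subst h; simp [mul_inv_cancel₀ (factorial_cast_ne (K := K) m)]
  · simp [h, Ne.symm h]

lemma ext_coord {v w : K[X]} (h : ∀ m, coord K m v = coord K m w) : v = w := by
  ext m
  exact mul_left_cancel₀ (factorial_cast_ne m) (h m)

lemma span_divPow : Submodule.span K (Set.range (divPow K)) = ⊤ := by
  rw [eq_top_iff]
  intro v _
  induction v using Polynomial.induction_on' with
  | add p q hp hq => exact add_mem (hp trivial) (hq trivial)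
  | monomial n k =>
    have : monomial n k = (k * n.factorial) • divPow K n := by
      rw [divPow, smul_monomial, smul_eq_mul, mul_assoc, mul_inv_cancel₀ (factorial_cast_ne n),
        mul_one]
    rw [this]
    exact Submodule.smul_mem _ _ (Submodule.subset_span ⟨n, rfl⟩)

lemma end_ext {b c : Module.End K K[X]} (h : ∀ n, b (divPow K n) = c (divPow K n)) : b = c :=
  LinearMap.ext_on_range span_divPow h

lemma end_ext_coord {b c : Module.End K K[X]}
    (h : ∀ m n, coord K m (b (divPow K n)) = coord K m (c (divPow K n))) : b = c :=
  end_ext fun n => ext_coord fun m => h m n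

lemma coord_eq_zero_of_natDegree_lt {v : K[X]} {m : ℕ} (h : v.natDegree < m) :
    coord K m v = 0 := by
  rw [coord_apply, coeff_eq_zero_of_natDegree_lt h, mul_zero]

lemma eq_sum_coord (v : K[X]) (M : ℕ) (h : ∀ m ≥ M, coord K m v = 0) :
    v = ∑ i ∈ Finset.range M, coord K i v • divPow K i := by
  apply ext_coord
  intro m
  simp only [map_sum, map_smul, coord_divPow, smul_eq_mul, mul_ite, mul_one, mul_zero,
    Finset.sum_ite_eq, Finset.mem_range]
  split_ifs with hm
  · rfl
  · exact h m (by omega)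

lemma derOp_divPow_succ (n : ℕ) : derOp K (divPow K (n + 1)) = divPow K n := by
  have h : (n : K) + 1 ≠ 0 := by exact_mod_cast n.succ_ne_zero
  have h' := factorial_cast_ne (K := K) n
  simp only [derOp, divPow, derivative_monomial, Nat.factorial_succ, Nat.cast_mul, Nat.cast_add,
    Nat.cast_one, Nat.add_sub_cancel]
  congr 1
  field_simp

lemma derOp_divPow_zero : derOp K (divPow K 0) = 0 := by
  simp [derOp, divPow]

lemma intOp_divPow (n : ℕ) : intOp K (divPow K n) = divPow K (n + 1) := by
  have h : (n : K) + 1 ≠ 0 := by exact_mod_cast n.succ_ne_zero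
  have h' := factorial_cast_ne (K := K) n
  have : divPow K n = ((n.factorial : K)⁻¹) • Polynomial.basisMonomials K n := by
    simp [divPow, coe_basisMonomials, smul_monomial]
  rw [this, map_smul, intOp, Module.Basis.constr_basis, X_pow_eq_monomial, smul_monomial,
    smul_monomial, divPow]
  congr 1
  simp only [Nat.factorial_succ, smul_eq_mul, Nat.cast_mul, Nat.cast_add, Nat.cast_one]
  field_simp

lemma xOp_divPow (n : ℕ) : xOp K (divPow K n) = ((n : K) + 1) • divPow K (n + 1) := by
  have h : (n : K) + 1 ≠ 0 := by exact_mod_cast n.succ_ne_zero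
  have h' := factorial_cast_ne (K := K) n
  simp only [xOp, LinearMap.mulLeft_apply, divPow, X_mul_monomial, smul_monomial,
    Nat.factorial_succ, smul_eq_mul, Nat.cast_mul, Nat.cast_add, Nat.cast_one]
  congr 1
  field_simp

lemma hOp_divPow (n : ℕ) : hOp K (divPow K n) = ((n : K) + 1) • divPow K n := by
  rw [hOp, Module.End.mul_apply, xOp_divPow, map_smul, derOp_divPow_succ]

lemma derOp_mul_intOp : derOp K * intOp K = 1 :=
  end_ext fun n => by
    rw [Module.End.mul_apply, intOp_divPow, derOp_divPow_succ, Module.End.one_apply]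

lemma derOp_pow_mul_intOp_pow (n : ℕ) : derOp K ^ n * intOp K ^ n = 1 := by
  induction n with
  | zero => simp
  | succ n ih =>
    rw [pow_succ, pow_succ', mul_assoc, ← mul_assoc (derOp K) (intOp K), derOp_mul_intOp, one_mul,
      ih]

lemma intOp_pow_divPow (k n : ℕ) : (intOp K ^ k) (divPow K n) = divPow K (n + k) := by
  induction k with
  | zero => simp
  | succ k ih => rw [pow_succ', Module.End.mul_apply, ih, intOp_divPow, add_assoc]

lemma derOp_pow_divPow (k n : ℕ) :
    (derOp K ^ k) (divPow K n) = if k ≤ n then divPow K (n - k) else 0 := by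
  induction k with
  | zero => simp
  | succ k ih =>
    rw [pow_succ', Module.End.mul_apply, ih]
    by_cases h : k ≤ n
    · rcases Nat.exists_eq_add_of_le h with ⟨r, rfl⟩
      rw [if_pos h, Nat.add_sub_cancel_left]
      cases r with
      | zero => simp [derOp_divPow_zero]
      | succ r =>
        rw [derOp_divPow_succ, if_pos (by omega)]
        congr 1
        omega
    · rw [if_neg h, if_neg (by omega), map_zero]

lemma eOp_divPow (i j n : ℕ) : eOp K i j (divPow K n) = if n = j then divPow K i else 0 := by
  simp only [eOp, LinearMap.sub_apply, Module.End.mul_apply, derOp_pow_divPow]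
  rcases lt_trichotomy n j with h | rfl | h
  · rw [if_neg (by omega), if_neg (by omega), if_neg (by omega)]; simp
  · simp [intOp_pow_divPow]
  · rw [if_pos (by omega), if_pos (by omega), if_neg (by omega), intOp_pow_divPow, intOp_pow_divPow,
      sub_eq_zero]
    congr 1
    omega

lemma eOp_apply (i j : ℕ) (v : K[X]) : eOp K i j v = coord K j v • divPow K i := by
  have : eOp K i j = (coord K j).smulRight (divPow K i) := end_ext fun n => by
    rw [eOp_divPow, LinearMap.smulRight_apply, coord_divPow]
    simp only [eq_comm (a := n)]
    split_ifs <;> simp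
  rw [this, LinearMap.smulRight_apply]

lemma eOp_mul_eOp (i j l : ℕ) : eOp K i j * eOp K j l = eOp K i l :=
  LinearMap.ext fun v => by
    simp [eOp_apply, coord_divPow]

end Basis

section EventuallyPolynomial

variable {K}

/-- `p` describes the entries of `b` in all but finitely many columns: on the `d`-th diagonal the
entry in column `n` is the value at `n` of the polynomial `p d`. -/
def HasSymbol (b : Module.End K K[X]) (p : ℤ →₀ K[X]) : Prop :=
  ∃ N : ℕ, ∀ n ≥ N, ∀ m : ℕ, coord K m (b (divPow K n)) = (p ((m : ℤ) - n)).eval (n : K)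

lemma HasSymbol.add {b c : Module.End K K[X]} {p q : ℤ →₀ K[X]} (hb : HasSymbol b p)
    (hc : HasSymbol c q) : HasSymbol (b + c) (p + q) := by
  obtain ⟨N, hN⟩ := hb
  obtain ⟨M, hM⟩ := hc
  refine ⟨max N M, fun n hn m => ?_⟩
  rw [LinearMap.add_apply, map_add, hN n (le_of_max_le_left hn), hM n (le_of_max_le_right hn),
    Finsupp.add_apply, eval_add]

lemma HasSymbol.smul {b : Module.End K K[X]} {p : ℤ →₀ K[X]} (k : K) (hb : HasSymbol b p) :
    HasSymbol (k • b) (k • p) := by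
  obtain ⟨N, hN⟩ := hb
  refine ⟨N, fun n hn m => ?_⟩
  rw [LinearMap.smul_apply, map_smul, hN n hn, Finsupp.smul_apply, eval_smul]

lemma HasSymbol.zero : HasSymbol (0 : Module.End K K[X]) 0 := ⟨0, by simp⟩

lemma HasSymbol.one : HasSymbol (1 : Module.End K K[X]) (Finsupp.single 0 1) := by
  refine ⟨0, fun n _ m => ?_⟩
  rw [Module.End.one_apply, coord_divPow, Finsupp.single_apply]
  by_cases h : m = n
  · subst h; simp
  · rw [if_neg h, if_neg (by omega), eval_zero]

lemma HasSymbol.mul_intOp {b : Module.End K K[X]} {p : ℤ →₀ K[X]} (hb : HasSymbol b p) :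
    ∃ q, HasSymbol (b * intOp K) q := by
  obtain ⟨N, hN⟩ := hb
  refine ⟨(p.mapRange (fun f => f.comp (X + 1)) zero_comp).equivMapDomain (Equiv.addRight 1),
    N, fun n hn m => ?_⟩
  rw [Module.End.mul_apply, intOp_divPow, hN (n + 1) (by omega), Finsupp.equivMapDomain_apply,
    Finsupp.mapRange_apply, eval_comp]
  have : (m : ℤ) - (n + 1) = m - n + -1 := by ring
  simp [this]

lemma HasSymbol.mul_xOp {b : Module.End K K[X]} {p : ℤ →₀ K[X]} (hb : HasSymbol b p) :
    ∃ q, HasSymbol (b * xOp K) q := by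
  obtain ⟨N, hN⟩ := hb
  refine ⟨(p.mapRange (fun f => (X + 1) * f.comp (X + 1)) (by simp)).equivMapDomain
    (Equiv.addRight 1), N, fun n hn m => ?_⟩
  rw [Module.End.mul_apply, xOp_divPow, map_smul, map_smul, hN (n + 1) (by omega),
    Finsupp.equivMapDomain_apply, Finsupp.mapRange_apply, eval_mul, eval_comp]
  have : (m : ℤ) - (n + 1) = m - n + -1 := by ring
  simp [this]

lemma HasSymbol.mul_derOp {b : Module.End K K[X]} {p : ℤ →₀ K[X]} (hb : HasSymbol b p) :
    ∃ q, HasSymbol (b * derOp K) q := by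
  obtain ⟨N, hN⟩ := hb
  refine ⟨(p.mapRange (fun f => f.comp (X - 1)) zero_comp).equivMapDomain (Equiv.subRight 1),
    N + 1, fun n hn m => ?_⟩
  obtain ⟨n, rfl⟩ : ∃ k, n = k + 1 := ⟨n - 1, by omega⟩
  rw [Module.End.mul_apply, derOp_divPow_succ, hN n (by omega), Finsupp.equivMapDomain_apply,
    Finsupp.mapRange_apply, eval_comp]
  simp [← sub_sub]

lemma exists_hasSymbol {b : Module.End K K[X]} (hb : b ∈ I1 K) : ∃ p, HasSymbol b p := by
  rw [I1, ← Subalgebra.mem_toSubmodule, Algebra.adjoin_eq_span] at hb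
  induction hb using Submodule.span_induction with
  | zero => exact ⟨_, HasSymbol.zero⟩
  | add b c _ _ hb hc =>
    obtain ⟨p, hp⟩ := hb
    obtain ⟨q, hq⟩ := hc
    exact ⟨_, hp.add hq⟩
  | smul k b _ hb =>
    obtain ⟨p, hp⟩ := hb
    exact ⟨_, hp.smul k⟩
  | mem b hb =>
    induction hb using Submonoid.closure_induction_right with
    | one => exact ⟨_, HasSymbol.one⟩
    | mul_right b _ c hc hb =>
      obtain ⟨p, hp⟩ := hb
      rcases hc with rfl | rfl | rfl
      exacts [hp.mul_xOp, hp.mul_derOp, hp.mul_intOp]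

/-- The rows of `b ∈ I₁` are finite. -/
lemma exists_row_bound {b : Module.End K K[X]} (hb : b ∈ I1 K) (i : ℕ) :
    ∃ M, ∀ n ≥ M, coord K i (b (divPow K n)) = 0 := by
  obtain ⟨p, N, hN⟩ := exists_hasSymbol hb
  obtain ⟨L, hL⟩ := p.support.bddBelow
  refine ⟨max N (i + L.natAbs + 1), fun n hn => ?_⟩
  rw [hN n (le_of_max_le_left hn)]
  have : p ((i : ℤ) - n) = 0 := by
    by_contra h
    have := hL (Finsupp.mem_support_iff.2 h)
    have := le_of_max_le_right hn
    omega
  rw [this, eval_zero]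

/-- The columns of `b` are finite. -/
lemma exists_col_bound (b : Module.End K K[X]) (j : ℕ) :
    ∃ M, ∀ m ≥ M, coord K m (b (divPow K j)) = 0 :=
  ⟨_, fun _ hm => coord_eq_zero_of_natDegree_lt (Nat.lt_of_succ_le hm)⟩

end EventuallyPolynomial

section NonDiagonal

variable {K}

lemma exists_eval_natCast_ne_zero {q : K[X]} (hq : q ≠ 0) :
    ∃ N : ℕ, ∀ n ≥ N, q.eval (n : K) ≠ 0 := by
  have hfin : {n : ℕ | q.eval (n : K) = 0}.Finite := by
    have := (q.finite_setOfPred_isRoot hq).preimage (f := fun n : ℕ => (n : K))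
      Nat.cast_injective.injOn
    exact this
  obtain ⟨N, hN⟩ := hfin.bddAbove
  exact ⟨N + 1, fun n hn h => by have := hN h; omega⟩

lemma eq_zero_of_eval_natCast {q : K[X]} (N : ℕ) (h : ∀ n ≥ N, q.eval (n : K) = 0) : q = 0 := by
  by_contra hq
  obtain ⟨M, hM⟩ := exists_eval_natCast_ne_zero hq
  exact hM (max N M) (le_max_right _ _) (h _ (le_max_left _ _))

lemma mem_Cen {a b : Module.End K K[X]} : b ∈ Cen K a ↔ b ∈ I1 K ∧ a * b = b * a := by
  rw [Cen, Algebra.mem_inf, Subalgebra.mem_centralizer_iff]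
  simp

lemma self_mem_Cen {a : Module.End K K[X]} (ha : a ∈ I1 K) : a ∈ Cen K a := mem_Cen.2 ⟨ha, rfl⟩

lemma mem_span_insert_of_leading {W : Type*} [AddCommGroup W] [Module K W] (w : ℕ → W) (c : ℕ → K)
    (M : ℕ) (hM : c M ≠ 0) (v : W) (hv : v = ∑ i ∈ Finset.range (M + 1), c i • w i) :
    w M ∈ Submodule.span K (insert v (w '' Set.Iio M)) := by
  have h1 : w M = (c M)⁻¹ • (v - ∑ i ∈ Finset.range M, c i • w i) := by
    rw [hv, Finset.sum_range_succ, add_sub_cancel_left, smul_smul, inv_mul_cancel₀ hM, one_smul]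
  rw [h1]
  refine Submodule.smul_mem _ _ (sub_mem (Submodule.subset_span (Set.mem_insert _ _))
    (sum_mem fun i hi => Submodule.smul_mem _ _ (Submodule.subset_span ?_)))
  exact Or.inr ⟨i, Finset.mem_range.1 hi, rfl⟩

/-- The centralizer of an operator raising almost all degrees is finitely generated. -/
lemma Cen_fg_of_pos {a : Module.End K K[X]} (haI : a ∈ I1 K) {p : ℤ →₀ K[X]} (hp : HasSymbol a p)
    (d : ℕ) (hd : 0 < d) (hpd : p d ≠ 0) (hgt : ∀ e : ℤ, (d : ℤ) < e → p e = 0) :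
    (Cen K a).FG := by
  rw [Subalgebra.fg_iff_finiteType]
  obtain ⟨N, hN⟩ := hp
  obtain ⟨M, hM⟩ := exists_eval_natCast_ne_zero hpd
  have : Module.Finite K[X] (Module.AEval' a) := by
    refine finite_aeval_of_raises a (divPow K) span_divPow (max N M) d hd fun n hn => ?_
    refine mem_span_insert_of_leading _ (fun i => coord K i (a (divPow K n))) _ ?_ _
      (eq_sum_coord _ _ fun m hm => ?_)
    · rw [hN n (le_of_max_le_left hn)]
      simpa using hM n (le_of_max_le_right hn)
    · rw [hN n (le_of_max_le_left hn), hgt _ (by omega), eval_zero]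
  exact finiteType_of_injective_end (⟨a, self_mem_Cen haI⟩ : Cen K a) a
    (Cen K a).val.toLinearMap Subtype.val_injective (fun _ => rfl) (fun _ => rfl)
    fun c => Subtype.ext (mem_Cen.1 c.2).2

lemma coord_comp_eq_sum (b : Module.End K K[X]) (i M : ℕ)
    (h : ∀ n ≥ M, coord K i (b (divPow K n)) = 0) :
    coord K i ∘ₗ b = ∑ j ∈ Finset.range M, coord K i (b (divPow K j)) • coord K j := by
  refine LinearMap.ext_on_range span_divPow fun n => ?_
  simp only [LinearMap.comp_apply, LinearMap.sum_apply, LinearMap.smul_apply, coord_divPow,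
    smul_eq_mul, mul_ite, mul_one, mul_zero, Finset.sum_ite_eq', Finset.mem_range]
  split_ifs with hn
  · rfl
  · exact h n (by omega)

/-- The span of the coordinate functionals. -/
def coordSpan (K : Type*) [Field K] : Submodule K (Module.Dual K K[X]) :=
  Submodule.span K (Set.range (coord K))

lemma dualMap_mem_coordSpan {b : Module.End K K[X]} (hb : b ∈ I1 K) :
    ∀ f ∈ coordSpan K, b.dualMap f ∈ coordSpan K := by
  intro f hf
  refine (Submodule.span_le (p := (coordSpan K).comap b.dualMap)).2 ?_ hf
  rintro _ ⟨i, rfl⟩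
  obtain ⟨M, hM⟩ := exists_row_bound hb i
  change coord K i ∘ₗ b ∈ coordSpan K
  rw [coord_comp_eq_sum b i M hM]
  exact sum_mem fun j _ => Submodule.smul_mem _ _ (Submodule.subset_span ⟨j, rfl⟩)

/-- The centralizer of an operator whose transpose raises almost all degrees is finitely
generated. -/
lemma Cen_fg_of_neg {a : Module.End K K[X]} (haI : a ∈ I1 K) {p : ℤ →₀ K[X]} (hp : HasSymbol a p)
    (d : ℕ) (hd : 0 < d) (hpd : p (-d) ≠ 0) (hlt : ∀ e : ℤ, e < -d → p e = 0) :
    (Cen K a).FG := by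
  rw [Subalgebra.fg_iff_finiteType]
  obtain ⟨N, hN⟩ := hp
  obtain ⟨M, hM⟩ := exists_eval_natCast_ne_zero hpd
  let w (n : ℕ) : coordSpan K := ⟨coord K n, Submodule.subset_span ⟨n, rfl⟩⟩
  let T : Module.End K (coordSpan K) := a.dualMap.restrict (dualMap_mem_coordSpan haI)
  have hw : Submodule.span K (Set.range w) = ⊤ := by
    have : Set.range w = (Subtype.val : coordSpan K → _) ⁻¹' Set.range (coord K) := by
      ext x
      simp [w, Subtype.ext_iff]
    rw [this]
    exact Submodule.span_span_coe_preimage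
  have : Module.Finite K[X] (Module.AEval' T) := by
    refine finite_aeval_of_raises T w hw (max N M) d hd fun n hn => ?_
    have hn1 := le_of_max_le_left hn
    have hn2 := le_of_max_le_right hn
    refine mem_span_insert_of_leading w (fun i => coord K n (a (divPow K i))) _ ?_ _ ?_
    · rw [hN _ (by omega)]
      have : (n : ℤ) - ((n + d : ℕ) : ℤ) = -d := by push_cast; ring
      rw [this]
      exact hM _ (by omega)
    · apply Subtype.ext
      rw [AddSubmonoidClass.coe_finsetSum]
      refine coord_comp_eq_sum a n _ fun m hm => ?_
      rw [hN _ (by omega), hlt _ (by omega), eval_zero]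
  let ρ : Cen K a →ₗ[K] Module.End K (coordSpan K) :=
    { toFun := fun c => c.1.dualMap.restrict (dualMap_mem_coordSpan (mem_Cen.1 c.2).1)
      map_add' := fun c d => by
        refine LinearMap.ext fun f => Subtype.ext (LinearMap.ext fun v => ?_)
        exact map_add f.1 _ _
      map_smul' := fun k c => by
        refine LinearMap.ext fun f => Subtype.ext (LinearMap.ext fun v => ?_)
        exact map_smul f.1 _ _ }
  have hz (c : Cen K a) : (⟨a, self_mem_Cen haI⟩ : Cen K a) * c = c * ⟨a, self_mem_Cen haI⟩ :=
    Subtype.ext (mem_Cen.1 c.2).2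
  refine finiteType_of_injective_end (W := coordSpan K) (⟨a, self_mem_Cen haI⟩ : Cen K a) T ρ ?_ ?_ ?_ hz
  · intro b c h
    refine Subtype.ext (end_ext_coord fun m n => ?_)
    exact LinearMap.congr_fun (congrArg Subtype.val (LinearMap.congr_fun h (w m))) (divPow K n)
  · intro c
    rw [hz]
    rfl
  · intro c
    rw [← hz]
    rfl

lemma aeval_hOp_divPow (q : K[X]) (n : ℕ) :
    aeval (hOp K) q (divPow K n) = q.eval ((n : K) + 1) • divPow K n := by
  induction q using Polynomial.induction_on with
  | C k => simp [Module.algebraMap_end_apply]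
  | add p q hp hq => simp [hp, hq, add_smul]
  | monomial m k h =>
    rw [pow_succ, ← mul_assoc, map_mul, Module.End.mul_apply, aeval_X, hOp_divPow, map_smul, h,
      smul_smul, eval_mul_X, mul_comm]

/-- The operators all of whose entries outside an `L × L` block vanish. -/
def blockSupported (K : Type*) [Field K] (L : ℕ) : Submodule K (Module.End K K[X]) where
  carrier := {g | (∀ n ≥ L, g (divPow K n) = 0) ∧ ∀ m ≥ L, ∀ v, coord K m (g v) = 0}
  add_mem' := fun {g h} hg hh => ⟨fun n hn => by simp [hg.1 n hn, hh.1 n hn],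
    fun m hm v => by simp [hg.2 m hm, hh.2 m hm]⟩
  zero_mem' := by simp
  smul_mem' := fun k g hg => ⟨fun n hn => by simp [hg.1 n hn], fun m hm v => by simp [hg.2 m hm]⟩

lemma blockSupported_mono {L M : ℕ} (h : L ≤ M) : blockSupported K L ≤ blockSupported K M :=
  fun _ hg => ⟨fun n hn => hg.1 n (h.trans hn), fun m hm => hg.2 m (h.trans hm)⟩

lemma eOp_mem_blockSupported (i j : ℕ) : eOp K i j ∈ blockSupported K (max i j + 1) := by
  refine ⟨fun n hn => ?_, fun m hm v => ?_⟩
  · rw [eOp_divPow, if_neg (by omega)]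
  · rw [eOp_apply, map_smul, coord_divPow, if_neg (by omega), smul_zero]

lemma eq_sum_mul_eOp (g : Module.End K K[X]) (M : ℕ) (h : ∀ n ≥ M, g (divPow K n) = 0) :
    g = ∑ j ∈ Finset.range M, g * eOp K j j := by
  refine end_ext fun n => ?_
  simp only [LinearMap.sum_apply, Module.End.mul_apply, eOp_apply, map_smul]
  simp only [coord_divPow, ite_smul, one_smul, zero_smul, Finset.sum_ite_eq', Finset.mem_range]
  split_ifs with hn
  · rfl
  · exact h n (by omega)

lemma eq_sum_eOp_mul (g : Module.End K K[X]) (M : ℕ) (h : ∀ m ≥ M, ∀ v, coord K m (g v) = 0) :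
    g = ∑ i ∈ Finset.range M, eOp K i i * g := by
  refine LinearMap.ext fun v => ?_
  simp only [LinearMap.sum_apply, Module.End.mul_apply, eOp_apply]
  exact eq_sum_coord _ _ fun m hm => h m hm v

lemma eOp_mul_mul_eOp (i j : ℕ) (g : Module.End K K[X]) :
    eOp K i i * (g * eOp K j j) = coord K i (g (divPow K j)) • eOp K i j := by
  refine LinearMap.ext fun v => ?_
  simp [eOp_apply, smul_smul, mul_comm]

lemma blockSupported_le_span (L : ℕ) : blockSupported K L ≤
    Submodule.span K (Set.image2 (eOp K) (Set.Iio L) (Set.Iio L)) := by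
  intro g hg
  rw [eq_sum_eOp_mul g L hg.2]
  refine sum_mem fun i hi => ?_
  nth_rw 1 [eq_sum_mul_eOp g L hg.1]
  rw [Finset.mul_sum]
  refine sum_mem fun j hj => ?_
  rw [eOp_mul_mul_eOp]
  exact Submodule.smul_mem _ _ (Submodule.subset_span
    ⟨i, Finset.mem_range.1 hi, j, Finset.mem_range.1 hj, rfl⟩)

lemma blockSupported_le_Fset (L : ℕ) : blockSupported K L ≤ Fset K :=
  (blockSupported_le_span L).trans (Submodule.span_mono (by
    rintro _ ⟨i, _, j, _, rfl⟩
    exact ⟨i, j, rfl⟩))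

lemma exists_mem_blockSupported {f : Module.End K K[X]} (hf : f ∈ Fset K) :
    ∃ L, f ∈ blockSupported K L := by
  induction hf using Submodule.span_induction with
  | mem f h =>
    obtain ⟨i, j, rfl⟩ := h
    exact ⟨_, eOp_mem_blockSupported i j⟩
  | zero => exact ⟨0, zero_mem _⟩
  | add f g _ _ hf hg =>
    obtain ⟨L, hL⟩ := hf
    obtain ⟨M, hM⟩ := hg
    exact ⟨max L M, add_mem (blockSupported_mono (le_max_left _ _) hL)
      (blockSupported_mono (le_max_right _ _) hM)⟩
  | smul k f _ hf =>
    obtain ⟨L, hL⟩ := hf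
    exact ⟨L, Submodule.smul_mem _ _ hL⟩

lemma coord_sum_eq_zero {g : Module.End K K[X]} {N m : ℕ} {v : K[X]}
    (hv : ∀ i ≥ N, coord K i v = 0) (h : ∀ i < N, coord K m (g (divPow K i)) = 0) :
    coord K m (g v) = 0 := by
  rw [eq_sum_coord v N hv, map_sum, map_sum]
  refine Finset.sum_eq_zero fun i hi => ?_
  rw [map_smul, map_smul, h i (Finset.mem_range.1 hi), smul_zero]

/-- The first `N` columns of `b` vanish below a common row. -/
lemma exists_cols_bound (b : Module.End K K[X]) (N : ℕ) :
    ∃ M, ∀ m ≥ M, ∀ j < N, coord K m (b (divPow K j)) = 0 := by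
  choose M hM using exists_col_bound b
  refine ⟨(Finset.range N).sup M, fun m hm j hj => hM j m ?_⟩
  exact (Finset.le_sup (f := M) (Finset.mem_range.2 hj)).trans hm

/-- The first `N` rows of `b ∈ I₁` vanish beyond a common column. -/
lemma exists_rows_bound {b : Module.End K K[X]} (hb : b ∈ I1 K) (N : ℕ) :
    ∃ M, ∀ n ≥ M, ∀ i < N, coord K i (b (divPow K n)) = 0 := by
  choose M hM using exists_row_bound hb
  refine ⟨(Finset.range N).sup M, fun n hn i hi => hM i n ?_⟩
  exact (Finset.le_sup (f := M) (Finset.mem_range.2 hi)).trans hn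

lemma mem_Fset_of_columns {c : Module.End K K[X]} (N : ℕ) (h : ∀ n ≥ N, c (divPow K n) = 0) :
    c ∈ Fset K := by
  obtain ⟨M, hM⟩ := exists_cols_bound c N
  refine blockSupported_le_Fset (max N M) ⟨fun n hn => h n (le_of_max_le_left hn), fun m hm v => ?_⟩
  have : coord K m ∘ₗ c = 0 := LinearMap.ext_on_range span_divPow fun n => by
    by_cases hn : n < N
    · exact hM m (le_of_max_le_right hm) n hn
    · simp [h n (by omega)]
  exact LinearMap.congr_fun this v

lemma aeval_hOp_mem (q : K[X]) : aeval (hOp K) q ∈ KH K := by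
  rw [KH, Algebra.adjoin_singleton_eq_range_aeval]
  exact ⟨q, rfl⟩

/-- An operator with diagonal symbol acts diagonally on almost all divided powers. -/
lemma HasSymbol.exists_diagonal {b : Module.End K K[X]} {p : ℤ →₀ K[X]} (hp : HasSymbol b p)
    (h0 : ∀ d, d ≠ 0 → p d = 0) :
    ∃ N, ∀ n ≥ N, b (divPow K n) = (p 0).eval (n : K) • divPow K n := by
  obtain ⟨N, hN⟩ := hp
  refine ⟨N, fun n hn => ext_coord fun m => ?_⟩
  rw [hN n hn, map_smul, coord_divPow]
  by_cases h : m = n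
  · subst h; simp
  · rw [h0 _ (by omega), if_neg h]; simp

lemma HasSymbol.mem_sup {a : Module.End K K[X]} {p : ℤ →₀ K[X]} (hp : HasSymbol a p)
    (h0 : ∀ d, d ≠ 0 → p d = 0) : a ∈ Subalgebra.toSubmodule (KH K) ⊔ Fset K := by
  obtain ⟨N, hN⟩ := hp.exists_diagonal h0
  refine Submodule.mem_sup.2 ⟨aeval (hOp K) ((p 0).comp (X - 1)), aeval_hOp_mem _,
    a - aeval (hOp K) ((p 0).comp (X - 1)), mem_Fset_of_columns N fun n hn => ?_, by abel⟩
  rw [LinearMap.sub_apply, aeval_hOp_divPow, hN n hn]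
  simp [eval_comp]

/-- If `a ∉ K[H] + F` then the centralizer of `a` is finitely generated. -/
lemma Cen_fg_of_not_mem {a : Module.End K K[X]} (haI : a ∈ I1 K)
    (ha : a ∉ Subalgebra.toSubmodule (KH K) ⊔ Fset K) : (Cen K a).FG := by
  obtain ⟨p, hp⟩ := exists_hasSymbol haI
  obtain ⟨d, hd, hpd⟩ : ∃ d, d ≠ 0 ∧ p d ≠ 0 := by
    by_contra! h
    exact ha (hp.mem_sup h)
  have hmem : d ∈ p.support := Finsupp.mem_support_iff.2 hpd
  rcases lt_or_gt_of_ne hd with h | h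
  · have hle := p.support.min'_le d hmem
    have hmin := Finsupp.mem_support_iff.1 (p.support.min'_mem ⟨d, hmem⟩)
    have hlt : ∀ e, e < p.support.min' ⟨d, hmem⟩ → p e = 0 := fun e he => by
      by_contra hpe
      exact absurd (p.support.min'_le e (Finsupp.mem_support_iff.2 hpe)) (by omega)
    obtain ⟨k, hk⟩ : ∃ k : ℕ, p.support.min' ⟨d, hmem⟩ = -(k : ℤ) :=
      ⟨(p.support.min' ⟨d, hmem⟩).natAbs, by omega⟩
    rw [hk] at hmin hlt hle
    exact Cen_fg_of_neg haI hp k (by omega) hmin hlt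
  · have hle := p.support.le_max' d hmem
    have hmax := Finsupp.mem_support_iff.1 (p.support.max'_mem ⟨d, hmem⟩)
    have hgt : ∀ e, p.support.max' ⟨d, hmem⟩ < e → p e = 0 := fun e he => by
      by_contra hpe
      exact absurd (p.support.le_max' e (Finsupp.mem_support_iff.2 hpe)) (by omega)
    obtain ⟨k, hk⟩ : ∃ k : ℕ, p.support.max' ⟨d, hmem⟩ = (k : ℤ) :=
      ⟨(p.support.max' ⟨d, hmem⟩).natAbs, by omega⟩
    rw [hk] at hmax hgt hle
    exact Cen_fg_of_pos haI hp k (by omega) hmax hgt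

end NonDiagonal

section Diagonal

variable {K}

/-- The operators that preserve the span of the first `N` divided powers and act on the others
diagonally, with eigenvalues given by a polynomial. -/
def blockDiag (K : Type*) [Field K] (N : ℕ) : Subalgebra K (Module.End K K[X]) where
  carrier := {b | (∃ q : K[X], ∀ n ≥ N, b (divPow K n) = q.eval (n : K) • divPow K n) ∧
    ∀ v, (∀ m ≥ N, coord K m v = 0) → ∀ m ≥ N, coord K m (b v) = 0}
  mul_mem' := by
    rintro b c ⟨⟨q, hq⟩, hb⟩ ⟨⟨r, hr⟩, hc⟩
    exact ⟨⟨q * r, fun n hn => by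
      rw [Module.End.mul_apply, hr n hn, map_smul, hq n hn, smul_smul, eval_mul, mul_comm]⟩,
      fun v hv => hb _ (hc v hv)⟩
  add_mem' := by
    rintro b c ⟨⟨q, hq⟩, hb⟩ ⟨⟨r, hr⟩, hc⟩
    exact ⟨⟨q + r, fun n hn => by rw [LinearMap.add_apply, hr n hn, hq n hn, eval_add, add_smul]⟩,
      fun v hv m hm => by rw [LinearMap.add_apply, map_add, hb v hv m hm, hc v hv m hm, add_zero]⟩
  algebraMap_mem' := fun k => ⟨⟨Polynomial.C k, fun n _ => by
      rw [Module.algebraMap_end_apply, eval_C]⟩,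
    fun v hv m hm => by rw [Module.algebraMap_end_apply, map_smul, hv m hm, smul_zero]⟩

lemma HasSymbol.exists_forall_mem_blockDiag {b : Module.End K K[X]} {p : ℤ →₀ K[X]}
    (hp : HasSymbol b p) (h0 : ∀ d, d ≠ 0 → p d = 0) : ∃ N, ∀ M ≥ N, b ∈ blockDiag K M := by
  obtain ⟨N, hN⟩ := hp.exists_diagonal h0
  obtain ⟨L, hL⟩ := exists_cols_bound b N
  refine ⟨max N L, fun M hM => ⟨⟨p 0, fun n hn => hN n (by omega)⟩, fun v hv m hm => ?_⟩⟩
  refine coord_sum_eq_zero hv fun i hi => ?_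
  by_cases hiN : i < N
  · exact hL m (by omega) i hiN
  · rw [hN i (by omega), map_smul, coord_divPow, if_neg (by omega), smul_zero]

lemma coord_apply_of_mem_blockDiag {b : Module.End K K[X]} {N : ℕ} (hb : b ∈ blockDiag K N)
    {q : K[X]} (hq : ∀ n ≥ N, b (divPow K n) = q.eval (n : K) • divPow K n) {m : ℕ} (hm : N ≤ m)
    (v : K[X]) : coord K m (b v) = q.eval (m : K) * coord K m v := by
  have : coord K m ∘ₗ b = q.eval (m : K) • coord K m := by
    refine LinearMap.ext_on_range span_divPow fun j => ?_
    rw [LinearMap.comp_apply, LinearMap.smul_apply, coord_divPow]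
    by_cases hj : j < N
    · rw [if_neg (by omega), smul_zero]
      refine hb.2 _ (fun i hi => ?_) m hm
      rw [coord_divPow, if_neg (by omega)]
    · rw [hq j (by omega), map_smul, coord_divPow]
      by_cases h : m = j
      · subst h; rfl
      · simp [h]
  exact LinearMap.congr_fun this v

lemma comp_X_add_C_sub_ne_zero {q : K[X]} (hq : ∀ k, q ≠ Polynomial.C k) {c : K} (hc : c ≠ 0) :
    q.comp (X + Polynomial.C c) - q ≠ 0 := by
  intro h
  have hstep (t : K) : q.eval (t + c) = q.eval t := by
    have := congrArg (eval t) h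
    simpa [eval_comp, sub_eq_zero] using this
  have hmul (n : ℕ) : q.eval (n * c) = q.eval 0 := by
    induction n with
    | zero => simp
    | succ n ih => rw [Nat.cast_succ, add_mul, one_mul, hstep, ih]
  refine hq (q.eval 0) (sub_eq_zero.1 ?_)
  have hcomp : (q - Polynomial.C (q.eval 0)).comp (Polynomial.C c * X) = 0 :=
    eq_zero_of_eval_natCast 0 fun n _ => by simp [eval_comp, hmul, mul_comm c]
  refine Polynomial.funext fun t => ?_
  have := congrArg (eval (c⁻¹ * t)) hcomp
  simpa [eval_comp, mul_inv_cancel_left₀ hc] using this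

/-- If `a` has a non-constant diagonal symbol, so does every element of its centralizer. -/
lemma symbol_eq_zero_of_commute {a b : Module.End K K[X]} {p r : ℤ →₀ K[X]} (ha : HasSymbol a p)
    (h0 : ∀ d, d ≠ 0 → p d = 0) (hp : ∀ k, p 0 ≠ Polynomial.C k) (hb : HasSymbol b r)
    (hab : a * b = b * a) : ∀ d, d ≠ 0 → r d = 0 := by
  intro d hd
  obtain ⟨N₁, h₁⟩ := ha.exists_forall_mem_blockDiag h0
  obtain ⟨N₂, h₂⟩ := ha.exists_diagonal h0
  obtain ⟨N₃, h₃⟩ := hb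
  let N := max N₁ N₂
  have hmul : ((p 0).comp (X + Polynomial.C (d : K)) - p 0) * r d = 0 := by
    refine eq_zero_of_eval_natCast (N + N₃ + d.natAbs) fun n hn => ?_
    obtain ⟨m, hm⟩ : ∃ m : ℕ, (m : ℤ) = n + d := ⟨(n + d).toNat, by omega⟩
    have hmK : (m : K) = n + d := by exact_mod_cast congrArg (Int.cast : ℤ → K) hm
    have hl : coord K m (a (b (divPow K n))) = (p 0).eval (m : K) * (r d).eval (n : K) := by
      rw [coord_apply_of_mem_blockDiag (h₁ N (le_max_left _ _)) (fun k hk => h₂ k (by omega))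
        (by omega), h₃ n (by omega)]
      congr 3
      omega
    have hr : coord K m (b (a (divPow K n))) = (p 0).eval (n : K) * (r d).eval (n : K) := by
      rw [h₂ n (by omega), map_smul, map_smul, h₃ n (by omega), smul_eq_mul]
      congr 3
      omega
    have hc : coord K m (a (b (divPow K n))) = coord K m (b (a (divPow K n))) :=
      congrArg (fun f : Module.End K K[X] => coord K m (f (divPow K n))) hab
    rw [hl, hr] at hc
    simp only [eval_mul, eval_sub, eval_comp, eval_add, eval_X, eval_C, ← hmK]
    rw [sub_mul, hc, sub_self]
  exact (mul_eq_zero.1 hmul).resolve_left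
    (comp_X_add_C_sub_ne_zero hp (by exact_mod_cast hd))

lemma eOp_notMem_blockDiag (N : ℕ) : eOp K N N ∉ blockDiag K N := by
  rintro ⟨⟨q, hq⟩, -⟩
  have hq' : q = 0 := eq_zero_of_eval_natCast (N + 1) fun n hn => by
    have := congrArg (coord K n) (hq n (by omega))
    rw [eOp_divPow, if_neg (by omega), map_zero, map_smul, coord_divPow, if_pos rfl, smul_eq_mul,
      mul_one] at this
    exact this.symm
  have := congrArg (coord K N) (hq N le_rfl)
  simp [eOp_divPow, coord_divPow, hq'] at this

lemma not_Cen_fg {a : Module.End K K[X]} {p : ℤ →₀ K[X]} (ha : HasSymbol a p)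
    (h0 : ∀ d, d ≠ 0 → p d = 0) (hp : ∀ k, p 0 ≠ Polynomial.C k) : ¬ (Cen K a).FG := by
  rintro ⟨t, ht⟩
  obtain ⟨N₁, h₁⟩ := ha.exists_forall_mem_blockDiag h0
  obtain ⟨N₂, h₂⟩ := ha.exists_diagonal h0
  have hex : ∀ b, ∃ N, b ∈ t → ∀ M ≥ N, b ∈ blockDiag K M := by
    intro b
    by_cases hb : b ∈ t
    · have hbC : b ∈ Cen K a := ht ▸ Algebra.subset_adjoin (Finset.mem_coe.2 hb)
      obtain ⟨hbI, hab⟩ := mem_Cen.1 hbC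
      obtain ⟨r, hr⟩ := exists_hasSymbol hbI
      obtain ⟨N, hN⟩ := hr.exists_forall_mem_blockDiag (symbol_eq_zero_of_commute ha h0 hp hr hab)
      exact ⟨N, fun _ => hN⟩
    · exact ⟨0, fun h => absurd h hb⟩
  choose f hf using hex
  let N := max (t.sup f) (max N₁ N₂)
  have hle : Cen K a ≤ blockDiag K N := by
    rw [← ht, Algebra.adjoin_le_iff]
    intro b hb
    exact hf b hb N ((Finset.le_sup (Finset.mem_coe.1 hb)).trans (le_max_left _ _))
  refine eOp_notMem_blockDiag N (hle (mem_Cen.2 ⟨eOp_mem K N N, LinearMap.ext fun v => ?_⟩))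
  rw [Module.End.mul_apply, Module.End.mul_apply, eOp_apply, eOp_apply, map_smul, h₂ N (by omega),
    coord_apply_of_mem_blockDiag (h₁ N (by omega)) (fun k hk => h₂ k (by omega)) le_rfl, smul_smul,
    mul_comm]

lemma hasSymbol_aeval_hOp (q : K[X]) :
    HasSymbol (aeval (hOp K) q) (Finsupp.single 0 (q.comp (X + 1))) := by
  refine ⟨0, fun n _ m => ?_⟩
  rw [aeval_hOp_divPow, map_smul, coord_divPow, Finsupp.single_apply]
  by_cases h : m = n
  · subst h; simp [eval_comp]
  · rw [if_neg h, if_neg (by omega), eval_zero, smul_zero]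

lemma hasSymbol_of_mem_Fset {f : Module.End K K[X]} (hf : f ∈ Fset K) : HasSymbol f 0 := by
  obtain ⟨L, hL⟩ := exists_mem_blockSupported hf
  exact ⟨L, fun n hn m => by simp [hL.1 n hn]⟩

/-- If `a ∈ K[H] + F` but `a ∉ K + F`, the centralizer of `a` is not finitely generated. -/
lemma not_Cen_fg_of_mem {a : Module.End K K[X]}
    (ha : a ∈ Subalgebra.toSubmodule (KH K) ⊔ Fset K)
    (ha' : a ∉ Submodule.span K {(1 : Module.End K K[X])} ⊔ Fset K) : ¬ (Cen K a).FG := by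
  obtain ⟨h, hh, f, hf, rfl⟩ := Submodule.mem_sup.1 ha
  rw [Subalgebra.mem_toSubmodule, KH, Algebra.adjoin_singleton_eq_range_aeval] at hh
  obtain ⟨q, rfl⟩ := hh
  have hsymb := (hasSymbol_aeval_hOp q).add (hasSymbol_of_mem_Fset hf)
  rw [add_zero] at hsymb
  refine not_Cen_fg hsymb (fun d hd => Finsupp.single_eq_of_ne hd) fun k hk => ha' ?_
  rw [Finsupp.single_eq_same] at hk
  have hq : q = Polynomial.C k := by
    have := congrArg (fun r : K[X] => r.comp (X - 1)) hk
    simpa [comp_assoc] using this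
  refine Submodule.mem_sup.2 ⟨_, Submodule.smul_mem _ k (Submodule.mem_span_singleton_self _), f, hf,
    ?_⟩
  rw [hq]
  simp [Algebra.algebraMap_eq_smul_one]

end Diagonal

section Finite

variable {K}

/-- The (non-unital) embedding of the algebra of operators into itself that shifts both indices
by `N`. -/
def shiftOp (N : ℕ) (c : Module.End K K[X]) : Module.End K K[X] :=
  intOp K ^ N * c * derOp K ^ N

lemma shiftOp_mul (N : ℕ) (c d : Module.End K K[X]) :
    shiftOp N (c * d) = shiftOp N c * shiftOp N d := by
  have : shiftOp N c * shiftOp N d =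
      intOp K ^ N * c * (derOp K ^ N * intOp K ^ N) * d * derOp K ^ N := by
    simp only [shiftOp, mul_assoc]
  rw [this, derOp_pow_mul_intOp_pow, mul_one, shiftOp, mul_assoc (intOp K ^ N) c d]

lemma shiftOp_mem {N : ℕ} {c : Module.End K K[X]} (hc : c ∈ I1 K) : shiftOp N c ∈ I1 K :=
  mul_mem (mul_mem (pow_mem (intOp_mem K) N) hc) (pow_mem (derOp_mem K) N)

lemma coord_derOp_pow (k m : ℕ) (v : K[X]) :
    coord K m ((derOp K ^ k) v) = coord K (m + k) v := by
  have : coord K m ∘ₗ (derOp K ^ k) = coord K (m + k) :=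
    LinearMap.ext_on_range span_divPow fun n => by
      rw [LinearMap.comp_apply, derOp_pow_divPow, coord_divPow]
      by_cases h : k ≤ n
      · rw [if_pos h, coord_divPow]
        congr 1
        exact propext (by omega)
      · rw [if_neg h, if_neg (by omega), map_zero]
  exact LinearMap.congr_fun this v

lemma mul_intOp_pow_eq_zero {f : Module.End K K[X]} {N : ℕ} (hf : f ∈ blockSupported K N) :
    f * intOp K ^ N = 0 :=
  end_ext fun n => by
    rw [Module.End.mul_apply, intOp_pow_divPow, hf.1 _ (by omega), LinearMap.zero_apply]

lemma derOp_pow_mul_eq_zero {f : Module.End K K[X]} {N : ℕ} (hf : f ∈ blockSupported K N) :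
    derOp K ^ N * f = 0 :=
  LinearMap.ext fun v => ext_coord fun m => by
    rw [Module.End.mul_apply, coord_derOp_pow, hf.2 _ (by omega), LinearMap.zero_apply, map_zero]

lemma shiftOp_one_divPow (N n : ℕ) :
    shiftOp N (1 : Module.End K K[X]) (divPow K n) = if N ≤ n then divPow K n else 0 := by
  rw [shiftOp, mul_one, Module.End.mul_apply, derOp_pow_divPow]
  split_ifs with h
  · rw [intOp_pow_divPow, Nat.sub_add_cancel h]
  · rw [map_zero]

lemma coord_shiftOp_one (N m : ℕ) (v : K[X]) :
    coord K m (shiftOp N (1 : Module.End K K[X]) v) = if N ≤ m then coord K m v else 0 := by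
  have : coord K m ∘ₗ shiftOp N (1 : Module.End K K[X]) = if N ≤ m then coord K m else 0 :=
    LinearMap.ext_on_range span_divPow fun n => by
      rw [LinearMap.comp_apply, shiftOp_one_divPow]
      by_cases h : m = n
      · subst h
        split_ifs <;> simp
      · split_ifs <;> simp [coord_divPow, h]
  rw [← LinearMap.comp_apply, this]
  split_ifs <;> rfl

lemma shiftOp_eOp (N i j : ℕ) : shiftOp N (eOp K i j) = eOp K (i + N) (j + N) :=
  LinearMap.ext fun v => by
    rw [shiftOp, Module.End.mul_apply, Module.End.mul_apply, eOp_apply, eOp_apply, map_smul,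
      coord_derOp_pow, intOp_pow_divPow]

lemma shiftOp_mem_of_generators {N : ℕ} {B : Subalgebra K (Module.End K K[X])}
    (h1 : shiftOp N 1 ∈ B) (hx : shiftOp N (xOp K) ∈ B) (hd : shiftOp N (derOp K) ∈ B)
    (hi : shiftOp N (intOp K) ∈ B) {c : Module.End K K[X]} (hc : c ∈ I1 K) : shiftOp N c ∈ B := by
  induction hc using Algebra.adjoin_induction with
  | mem c hc =>
    rcases hc with rfl | rfl | rfl
    exacts [hx, hd, hi]
  | algebraMap k =>
    have : shiftOp N (algebraMap K (Module.End K K[X]) k) = k • shiftOp N 1 := by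
      rw [Algebra.algebraMap_eq_smul_one, shiftOp, shiftOp, mul_smul_comm, smul_mul_assoc]
    rw [this]
    exact B.smul_mem h1 k
  | add c d _ _ hc hd =>
    have : shiftOp N (c + d) = shiftOp N c + shiftOp N d := by
      rw [shiftOp, mul_add, add_mul]; rfl
    rw [this]
    exact add_mem hc hd
  | mul c d _ _ hc hd =>
    rw [shiftOp_mul]
    exact mul_mem hc hd

/-- The centralizer of a finite matrix is contained in every subalgebra that contains the shifted
copy of `I₁` and the finite matrices in the centralizer of slightly larger size. -/
lemma mem_of_mem_Cen {f : Module.End K K[X]} {N : ℕ} (hf : f ∈ blockSupported K N)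
    {B : Subalgebra K (Module.End K K[X])} (hsh : ∀ c ∈ I1 K, shiftOp N c ∈ B)
    (hfin : ∀ g ∈ I1 K, f * g = g * f → g ∈ blockSupported K (N + 1) → g ∈ B)
    {b : Module.End K K[X]} (hb : b ∈ Cen K f) : b ∈ B := by
  obtain ⟨hbI, hfb⟩ := mem_Cen.1 hb
  set P : Module.End K K[X] := shiftOp N 1 with hP
  have hPI : P ∈ I1 K := shiftOp_mem (one_mem _)
  have hfP : f * P = 0 := by
    rw [hP, shiftOp, mul_one, ← mul_assoc, mul_intOp_pow_eq_zero hf, zero_mul]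
  have hPf : P * f = 0 := by
    rw [hP, shiftOp, mul_one, mul_assoc, derOp_pow_mul_eq_zero hf, mul_zero]
  have hsplit : b = P * b * P + (1 - P) * b * (1 - P) + (1 - P) * b * P + P * b * (1 - P) := by
    simp only [mul_sub, sub_mul, mul_one, one_mul]
    abel
  have hQI : 1 - P ∈ I1 K := sub_mem (one_mem _) hPI
  have hfQ : f * (1 - P) = f := by rw [mul_sub, mul_one, hfP, sub_zero]
  have hQf : (1 - P) * f = f := by rw [sub_mul, one_mul, hPf, sub_zero]
  have hQ_divPow (n : ℕ) (hn : N ≤ n) : (1 - P) (divPow K n) = 0 := by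
    rw [LinearMap.sub_apply, hP, shiftOp_one_divPow, if_pos hn, Module.End.one_apply, sub_self]
  have hcoord_Q (m : ℕ) (hm : N ≤ m) (v : K[X]) : coord K m ((1 - P) v) = 0 := by
    rw [LinearMap.sub_apply, map_sub, hP, coord_shiftOp_one, if_pos hm, Module.End.one_apply,
      sub_self]
  rw [hsplit]
  refine add_mem (add_mem (add_mem ?_ ?_) ?_) ?_
  · have : P * b * P = shiftOp N (derOp K ^ N * b * intOp K ^ N) := by
      simp only [hP, shiftOp, mul_one, mul_assoc]
    rw [this]
    exact hsh _ (mul_mem (mul_mem (pow_mem (derOp_mem K) N) hbI) (pow_mem (intOp_mem K) N))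
  · refine hfin _ (mul_mem (mul_mem hQI hbI) hQI) ?_ (blockSupported_mono N.le_succ ⟨?_, ?_⟩)
    · rw [← mul_assoc, ← mul_assoc, hfQ, hfb, mul_assoc, hfQ, mul_assoc, hQf, mul_assoc, ← hfb,
        ← mul_assoc, hQf]
    · intro n hn
      rw [Module.End.mul_apply, hQ_divPow n hn, map_zero]
    · intro m hm v
      rw [mul_assoc, Module.End.mul_apply, hcoord_Q m hm]
  · set g := (1 - P) * b * P with hg
    have hgI : g ∈ I1 K := mul_mem (mul_mem hQI hbI) hPI
    have hfg : f * g = 0 := by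
      rw [hg, ← mul_assoc, ← mul_assoc, hfQ, hfb, mul_assoc, hfP, mul_zero]
    have hcg (m : ℕ) (hm : N ≤ m) (v : K[X]) : coord K m (g v) = 0 := by
      rw [hg, mul_assoc, Module.End.mul_apply, hcoord_Q m hm]
    obtain ⟨M, hM⟩ := exists_rows_bound hgI N
    have hgM : ∀ n ≥ M, g (divPow K n) = 0 := fun n hn => ext_coord fun m => by
      rw [map_zero]
      by_cases hm : m < N
      · exact hM n hn m hm
      · exact hcg m (by omega) _
    rw [eq_sum_mul_eOp g M hgM]
    refine sum_mem fun j _ => ?_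
    by_cases hj : j < N
    · have : g * eOp K j j = 0 := LinearMap.ext fun v => by
        rw [Module.End.mul_apply, eOp_apply, map_smul, hg, Module.End.mul_apply, hP,
          shiftOp_one_divPow, if_neg (by omega), map_zero, smul_zero, LinearMap.zero_apply]
      rw [this]
      exact zero_mem _
    · rw [← eOp_mul_eOp j N j, ← mul_assoc]
      refine mul_mem (hfin _ (mul_mem hgI (eOp_mem K j N)) ?_ ⟨fun n hn => ?_, fun m hm v => ?_⟩) ?_
      · rw [← mul_assoc, hfg, zero_mul]
        refine (LinearMap.ext fun v => ?_).symm
        rw [Module.End.mul_apply, Module.End.mul_apply, eOp_apply, hf.2 N le_rfl, zero_smul,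
          map_zero, LinearMap.zero_apply]
      · rw [Module.End.mul_apply, eOp_divPow, if_neg (by omega), map_zero]
      · rw [Module.End.mul_apply, hcg m (by omega)]
      · have := hsh _ (eOp_mem K 0 (j - N))
        rwa [shiftOp_eOp, zero_add, Nat.sub_add_cancel (by omega)] at this
  · set h := P * b * (1 - P) with hh
    have hhI : h ∈ I1 K := mul_mem (mul_mem hPI hbI) hQI
    have hhf : h * f = 0 := by
      rw [hh, mul_assoc, hQf, mul_assoc, ← hfb, ← mul_assoc, hPf, zero_mul]
    have hhn (n : ℕ) (hn : N ≤ n) : h (divPow K n) = 0 := by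
      rw [hh, Module.End.mul_apply, hQ_divPow n hn, map_zero]
    obtain ⟨M, hM⟩ := exists_cols_bound h N
    have hhM : ∀ m ≥ M, ∀ v, coord K m (h v) = 0 := fun m hm v => by
      have : coord K m ∘ₗ h = 0 := LinearMap.ext_on_range span_divPow fun n => by
        rw [LinearMap.comp_apply]
        by_cases hn : n < N
        · exact hM m hm n hn
        · rw [hhn n (by omega), map_zero, LinearMap.zero_apply]
      exact LinearMap.congr_fun this v
    rw [eq_sum_eOp_mul h M hhM]
    refine sum_mem fun i _ => ?_
    by_cases hi : i < N
    · have : eOp K i i * h = 0 := LinearMap.ext fun v => by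
        rw [Module.End.mul_apply, eOp_apply, hh, mul_assoc, Module.End.mul_apply, hP,
          coord_shiftOp_one, if_neg (by omega), zero_smul, LinearMap.zero_apply]
      rw [this]
      exact zero_mem _
    · rw [← eOp_mul_eOp i N i, mul_assoc]
      refine mul_mem ?_ (hfin _ (mul_mem (eOp_mem K N i) hhI) ?_ ⟨fun n hn => ?_, fun m hm v => ?_⟩)
      · have := hsh _ (eOp_mem K (i - N) 0)
        rwa [shiftOp_eOp, zero_add, Nat.sub_add_cancel (by omega)] at this
      · rw [mul_assoc, hhf, mul_zero]
        refine LinearMap.ext fun v => ?_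
        rw [Module.End.mul_apply, Module.End.mul_apply, eOp_apply, map_smul, hf.1 N le_rfl,
          smul_zero, LinearMap.zero_apply]
      · rw [Module.End.mul_apply, hhn n (by omega), map_zero]
      · rw [Module.End.mul_apply, eOp_apply, map_smul, coord_divPow, if_neg (by omega), smul_zero]

instance finiteDimensional_blockSupported (L : ℕ) : FiniteDimensional K (blockSupported K L) := by
  have : FiniteDimensional K
      (Submodule.span K (Set.image2 (eOp K) (Set.Iio L) (Set.Iio L))) :=
    FiniteDimensional.span_of_finite K ((Set.finite_Iio L).image2 _ (Set.finite_Iio L))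
  exact Submodule.finiteDimensional_of_le (blockSupported_le_span L)

lemma Cen_fg_of_mem_blockSupported {f : Module.End K K[X]} {N : ℕ}
    (hf : f ∈ blockSupported K N) : (Cen K f).FG := by
  classical
  let E : Submodule K (Module.End K K[X]) :=
    blockSupported K (N + 1) ⊓ Subalgebra.toSubmodule (Cen K f)
  have hE : FiniteDimensional K E := Submodule.finiteDimensional_of_le inf_le_left
  obtain ⟨s, hs⟩ : E.FG := Module.Finite.iff_fg.1 hE
  let t : Finset (Module.End K K[X]) :=
    {shiftOp N 1, shiftOp N (xOp K), shiftOp N (derOp K), shiftOp N (intOp K)}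
  have hshC (c : Module.End K K[X]) (hc : c ∈ I1 K) : shiftOp N c ∈ Cen K f := by
    refine mem_Cen.2 ⟨shiftOp_mem hc, ?_⟩
    rw [shiftOp, ← mul_assoc, ← mul_assoc, mul_intOp_pow_eq_zero hf, mul_assoc _ _ f,
      derOp_pow_mul_eq_zero hf, zero_mul, zero_mul, mul_zero]
  refine ⟨s ∪ t, le_antisymm (Algebra.adjoin_le ?_) ?_⟩
  · intro b hb
    rcases Finset.mem_union.1 (Finset.mem_coe.1 hb) with h | h
    · have : b ∈ E := hs ▸ Submodule.subset_span (Finset.mem_coe.2 h)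
      exact this.2
    · simp only [t, Finset.mem_insert, Finset.mem_singleton] at h
      rcases h with rfl | rfl | rfl | rfl
      exacts [hshC _ (one_mem _), hshC _ (xOp_mem K), hshC _ (derOp_mem K), hshC _ (intOp_mem K)]
  · intro b hb
    have ht {c : Module.End K K[X]} (hc : c ∈ t) :
        c ∈ Algebra.adjoin K ((s ∪ t : Finset _) : Set (Module.End K K[X])) :=
      Algebra.subset_adjoin (Finset.mem_coe.2 (Finset.mem_union_right _ hc))
    refine mem_of_mem_Cen hf (fun c hc => shiftOp_mem_of_generators (ht (by simp [t]))
      (ht (by simp [t])) (ht (by simp [t])) (ht (by simp [t])) hc) (fun g hgI hfg hg => ?_) hb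
    have hgE : g ∈ Submodule.span K (s : Set (Module.End K K[X])) :=
      hs ▸ ⟨hg, mem_Cen.2 ⟨hgI, hfg⟩⟩
    refine Algebra.span_le_adjoin K _ (Submodule.span_mono ?_ hgE)
    exact_mod_cast Finset.subset_union_left

/-- If `a ∈ K + F`, the centralizer of `a` is finitely generated. -/
lemma Cen_fg_of_mem {a : Module.End K K[X]}
    (ha : a ∈ Submodule.span K {(1 : Module.End K K[X])} ⊔ Fset K) : (Cen K a).FG := by
  obtain ⟨c, hc, f, hf, rfl⟩ := Submodule.mem_sup.1 ha
  obtain ⟨k, rfl⟩ := Submodule.mem_span_singleton.1 hc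
  obtain ⟨N, hN⟩ := exists_mem_blockSupported hf
  have : Cen K (k • 1 + f) = Cen K f := by
    ext b
    simp [mem_Cen, add_mul, mul_add]
  rw [this]
  exact Cen_fg_of_mem_blockSupported hN

end Finite

/-- for a non-scalar `a ∈ I₁`, `Cen_{I₁}(a)` is a finitely generated
`K`-algebra iff `a ∉ K[H]+F` or `a ∈ K+F`. -/
theorem statement16 (a : Module.End K (Polynomial K)) (haI : a ∈ I1 K)
    (ha : a ∉ Set.range (algebraMap K (Module.End K (Polynomial K)))) :
    (Cen K a).FG ↔
      (a ∉ Subalgebra.toSubmodule (KH K) ⊔ Fset K ∨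
        a ∈ Submodule.span K {(1 : Module.End K (Polynomial K))} ⊔ Fset K) := by
  refine ⟨fun h => ?_, fun h => h.elim (Cen_fg_of_not_mem haI) Cen_fg_of_mem⟩
  by_contra! hcon
  exact not_Cen_fg_of_mem hcon.1 hcon.2 h

end
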